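/- Let p ≥ 1, let f : [0,1]^p → ℝ be continuous, and for a nonempty subset A ⊆ {1,…,p} define the BLA loss L(A) = min over φ_0 ∈ ℝ and (φ_j)_{j∈A} ∈ ℝ^{|A|} of ∫_{[0,1]^p}[f(x) − (φ_0 + ∑_{j∈A} φ_j x_j)]^2 dx, and set β_j = 12(∫_{[0,1]^p} x_j f(x) dx − (1/2)∫_{[0,1]^p} f(x) dx) for j = 1,…,p. Then for any two nonempty subsets A, B ⊆ {1,…,p}, L(B) − L(A) = (1/12)(∑_{j ∈ A\B} β_j² − ∑_{j ∈ B\A} β_j²). -/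

import Mathlib

open MeasureTheory

/-- Expansion of the squared error of an affine approximation in centred, pairwise orthogonal
regressors of equal variance `v`, around the optimal coefficients `b`. -/
lemma integral_sq_sub_affine {Ω ι : Type*} [MeasurableSpace Ω] [DecidableEq ι] {μ : Measure Ω}
    [IsProbabilityMeasure μ] {f : Ω → ℝ} {u : ι → Ω → ℝ} {v : ℝ} {b : ι → ℝ}
    (hf : MemLp f 2 μ) (hu : ∀ i, MemLp (u i) 2 μ) (hu0 : ∀ i, ∫ x, u i x ∂μ = 0)
    (huu : ∀ i j, ∫ x, u i x * u j x ∂μ = if i = j then v else 0)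
    (hfu : ∀ i, ∫ x, f x * u i x ∂μ = v * b i) (A : Finset ι) (c : ℝ) (φ : ι → ℝ) :
    ∫ x, (f x - (c + ∑ j ∈ A, φ j * u j x)) ^ 2 ∂μ =
      (∫ x, f x ^ 2 ∂μ) - (∫ x, f x ∂μ) ^ 2 - v * ∑ j ∈ A, b j ^ 2
        + ((∫ x, f x ∂μ) - c) ^ 2 + v * ∑ j ∈ A, (φ j - b j) ^ 2 := by
  have if1 : Integrable f μ := hf.integrable (by norm_num)
  have iu1 i : Integrable (u i) μ := (hu i).integrable (by norm_num)
  have iff2 : Integrable (fun x => f x ^ 2) μ := hf.integrable_sq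
  have ifu i : Integrable (fun x => f x * u i x) μ := hf.integrable_mul (hu i)
  have iuu i j : Integrable (fun x => u i x * u j x) μ := (hu i).integrable_mul (hu j)
  have expand : ∀ x, (f x - (c + ∑ j ∈ A, φ j * u j x)) ^ 2 =
      f x ^ 2 - 2 * c * f x + c ^ 2 + ∑ j ∈ A, (2 * c * φ j) * u j x
        - ∑ j ∈ A, (2 * φ j) * (f x * u j x)
        + ∑ i ∈ A, ∑ j ∈ A, (φ i * φ j) * (u i x * u j x) := by
    intro x
    have e1 : ∑ j ∈ A, (2 * c * φ j) * u j x = 2 * c * ∑ j ∈ A, φ j * u j x := by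
      rw [Finset.mul_sum]; exact Finset.sum_congr rfl fun _ _ => by ring
    have e2 : ∑ j ∈ A, (2 * φ j) * (f x * u j x) = 2 * f x * ∑ j ∈ A, φ j * u j x := by
      rw [Finset.mul_sum]; exact Finset.sum_congr rfl fun _ _ => by ring
    have e3 : ∑ i ∈ A, ∑ j ∈ A, (φ i * φ j) * (u i x * u j x) =
        (∑ j ∈ A, φ j * u j x) * ∑ j ∈ A, φ j * u j x := by
      rw [Finset.sum_mul_sum]
      exact Finset.sum_congr rfl fun _ _ => Finset.sum_congr rfl fun _ _ => by ring
    rw [e1, e2, e3]; ring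
  have i1 : Integrable (fun x => ∑ j ∈ A, (2 * c * φ j) * u j x) μ :=
    integrable_finsetSum _ fun j _ => (iu1 j).const_mul _
  have i2 : Integrable (fun x => ∑ j ∈ A, (2 * φ j) * (f x * u j x)) μ :=
    integrable_finsetSum _ fun j _ => (ifu j).const_mul _
  have i3' i : Integrable (fun x => ∑ j ∈ A, (φ i * φ j) * (u i x * u j x)) μ :=
    integrable_finsetSum _ fun j _ => (iuu i j).const_mul _
  have i3 : Integrable (fun x => ∑ i ∈ A, ∑ j ∈ A, (φ i * φ j) * (u i x * u j x)) μ :=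
    integrable_finsetSum _ fun i _ => i3' i
  have j1 : Integrable (fun x => f x ^ 2 - 2 * c * f x) μ := iff2.sub (if1.const_mul _)
  have j2 : Integrable (fun x => f x ^ 2 - 2 * c * f x + c ^ 2) μ := j1.add (integrable_const _)
  have j3 : Integrable (fun x => f x ^ 2 - 2 * c * f x + c ^ 2
      + ∑ j ∈ A, (2 * c * φ j) * u j x) μ := j2.add i1
  have j4 : Integrable (fun x => f x ^ 2 - 2 * c * f x + c ^ 2
      + ∑ j ∈ A, (2 * c * φ j) * u j x - ∑ j ∈ A, (2 * φ j) * (f x * u j x)) μ := j3.sub i2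
  simp_rw [expand]
  rw [integral_add j4 i3, integral_sub j3 i2, integral_add j2 i1,
    integral_add j1 (integrable_const _), integral_sub iff2 (if1.const_mul _),
    integral_finsetSum _ fun j _ => (iu1 j).const_mul _,
    integral_finsetSum _ fun j _ => (ifu j).const_mul _,
    integral_finsetSum _ fun i _ => i3' i]
  simp_rw [integral_finsetSum A fun j _ => (iuu _ j).const_mul _, integral_const_mul, hu0, huu, hfu]
  simp only [mul_ite, mul_zero, Finset.sum_ite_eq, Finset.sum_const_zero, integral_const,
    probReal_univ, one_smul]
  have e4 : ∑ i ∈ A, (if i ∈ A then φ i * φ i * v else 0) = ∑ i ∈ A, φ i * φ i * v :=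
    Finset.sum_congr rfl fun i hi => by simp [hi]
  have e5 : v * ∑ j ∈ A, (φ j - b j) ^ 2 = v * ∑ j ∈ A, b j ^ 2 + ∑ i ∈ A, φ i * φ i * v
      - ∑ j ∈ A, 2 * φ j * (v * b j) := by
    simp_rw [Finset.mul_sum]
    rw [← Finset.sum_add_distrib, ← Finset.sum_sub_distrib]
    exact Finset.sum_congr rfl fun _ _ => by ring
  rw [e4, e5]; ring

lemma ciInf_ciInf_eq_of_le_of_eq {α γ : Type*} [Nonempty γ] {F : α → γ → ℝ} {K : ℝ}
    (hle : ∀ a c, K ≤ F a c) {a : α} {c : γ} (heq : F a c = K) : ⨅ a, ⨅ c, F a c = K := by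
  have : Nonempty α := ⟨a⟩
  have hin a : K ≤ ⨅ c, F a c := le_ciInf (hle a)
  refine le_antisymm ?_ (le_ciInf hin)
  refine (ciInf_le ⟨K, Set.forall_mem_range.2 hin⟩ a).trans ?_
  exact (ciInf_le ⟨K, Set.forall_mem_range.2 (hle a)⟩ c).trans heq.le

lemma volume_restrict_unitCube (ι : Type*) [Fintype ι] :
    (volume : Measure (ι → ℝ)).restrict (Set.univ.pi fun _ => Set.Icc (0:ℝ) 1) =
      Measure.pi fun _ => volume.restrict (Set.Icc (0:ℝ) 1) := by
  rw [volume_pi, Measure.restrict_pi_pi]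

instance isProbabilityMeasure_restrict_Icc_zero_one :
    IsProbabilityMeasure ((volume : Measure ℝ).restrict (Set.Icc (0:ℝ) 1)) :=
  ⟨by simp⟩

lemma setIntegral_unitCube_comp_eval {ι : Type*} [Fintype ι] (i : ι) {g : ℝ → ℝ}
    (hg : Continuous g) :
    ∫ x in Set.univ.pi fun _ : ι => Set.Icc (0:ℝ) 1, g (x i) = ∫ t in (0:ℝ)..1, g t := by
  rw [volume_restrict_unitCube, intervalIntegral.integral_of_le zero_le_one,
    ← integral_Icc_eq_integral_Ioc]
  exact integral_comp_eval (μ := fun _ : ι => (volume : Measure ℝ).restrict (Set.Icc (0:ℝ) 1))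
    hg.aestronglyMeasurable

lemma integral_centred_coord {ι : Type*} [Fintype ι] (i : ι) :
    ∫ x in Set.univ.pi fun _ : ι => Set.Icc (0:ℝ) 1, (x i - 1/2) = 0 := by
  rw [setIntegral_unitCube_comp_eval i (g := fun t => t - 1/2) (by fun_prop)]
  simp

lemma integral_centred_coord_mul {ι : Type*} [Fintype ι] [DecidableEq ι] (i j : ι) :
    ∫ x in Set.univ.pi fun _ : ι => Set.Icc (0:ℝ) 1, (x i - 1/2) * (x j - 1/2) =
      if i = j then 1/12 else 0 := by
  split_ifs with h
  · subst h
    simp_rw [← pow_two]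
    rw [setIntegral_unitCube_comp_eval i (g := fun t => (t - 1/2) ^ 2) (by fun_prop),
      intervalIntegral.integral_comp_sub_right (fun t : ℝ => t ^ 2), integral_pow]
    norm_num
  · have h0 := integral_centred_coord i
    rw [volume_restrict_unitCube] at h0 ⊢
    have hind := (ProbabilityTheory.iIndepFun_pi
      (μ := fun _ : ι => (volume : Measure ℝ).restrict (Set.Icc (0:ℝ) 1))
      (X := fun _ (t : ℝ) => t - 1/2) (fun _ => by fun_prop)).indepFun h
    have hm (k : ι) : Measurable fun x : ι → ℝ => x k - 1/2 := by fun_prop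
    rw [hind.integral_fun_mul_eq_mul_integral (hm i).aestronglyMeasurable
      (hm j).aestronglyMeasurable, h0, zero_mul]

lemma ContinuousOn.memLp_two_restrict {X : Type*} [TopologicalSpace X] [MeasurableSpace X]
    [OpensMeasurableSpace X] [T2Space X] {μ : Measure X} [IsFiniteMeasureOnCompacts μ] {s : Set X}
    {g : X → ℝ} (hg : ContinuousOn g s) (hs : IsCompact s) : MemLp g 2 (μ.restrict s) :=
  (memLp_two_iff_integrable_sq
    (hg.aestronglyMeasurable_of_isCompact hs hs.measurableSet)).2
    ((hg.pow 2).integrableOn_compact' hs hs.measurableSet)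

/-- The difference of BLA losses between two nonempty variable subsets `A` and `B` equals
`(1/12)(∑_{j ∈ A\B} β_j² − ∑_{j ∈ B\A} β_j²)`, where `β_j` are the BLA coefficients. -/
theorem bla_loss_difference (p : ℕ) (hp : 1 ≤ p) (f : (Fin p → ℝ) → ℝ)
    (cube : Set (Fin p → ℝ))
    (hcube : cube = Set.univ.pi fun _ : Fin p => Set.Icc (0:ℝ) 1)
    (hf : ContinuousOn f cube)
    (β : Fin p → ℝ)
    (hβ : ∀ j, β j = 12 * ((∫ x in cube, x j * f x) - (1/2) * ∫ x in cube, f x))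
    (L : Finset (Fin p) → ℝ)
    (hL : ∀ A, L A = ⨅ φ₀ : ℝ, ⨅ φ : Fin p → ℝ,
      ∫ x in cube, (f x - (φ₀ + ∑ j ∈ A, φ j * x j))^2)
    (A B : Finset (Fin p)) (hA : A.Nonempty) (hB : B.Nonempty) :
    L B - L A = (1/12) * ((∑ j ∈ A \ B, (β j)^2) - ∑ j ∈ B \ A, (β j)^2) := by
  have hcompact : IsCompact cube := hcube ▸ isCompact_univ_pi fun _ => isCompact_Icc
  have hprob : IsProbabilityMeasure (volume.restrict cube) := by
    rw [hcube, volume_restrict_unitCube]; infer_instance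
  have hfL : MemLp f 2 (volume.restrict cube) := hf.memLp_two_restrict hcompact
  have hcoord j : MemLp (fun x : Fin p → ℝ => x j) 2 (volume.restrict cube) :=
    (continuous_apply j).continuousOn.memLp_two_restrict hcompact
  have hu j : MemLp (fun x : Fin p → ℝ => x j - 1/2) 2 (volume.restrict cube) :=
    (hcoord j).sub (memLp_const _)
  have hfu j : ∫ x in cube, f x * (x j - 1/2) = 1/12 * β j := by
    have e (x : Fin p → ℝ) : f x * (x j - 1/2) = x j * f x - 1/2 * f x := by ring
    have hxf : Integrable (fun x => x j * f x) (volume.restrict cube) :=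
      (hcoord j).integrable_mul hfL
    simp_rw [e]
    rw [integral_sub hxf ((hfL.integrable (by norm_num)).const_mul _), integral_const_mul, hβ]
    ring
  have hloss A φ₀ φ := integral_sq_sub_affine hfL hu
    (fun i => by rw [hcube]; exact integral_centred_coord i)
    (fun i j => by rw [hcube]; exact integral_centred_coord_mul i j) hfu A
    (φ₀ + ∑ j ∈ A, φ j * (1/2)) φ
  have hrecentre (A : Finset (Fin p)) (φ₀ : ℝ) (φ x : Fin p → ℝ) :
      φ₀ + ∑ j ∈ A, φ j * (1/2) + ∑ j ∈ A, φ j * (x j - 1/2) = φ₀ + ∑ j ∈ A, φ j * x j := by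
    rw [add_assoc, ← Finset.sum_add_distrib]
    exact congrArg _ (Finset.sum_congr rfl fun _ _ => by ring)
  simp_rw [hrecentre] at hloss
  have hmin A : L A = (∫ x in cube, f x ^ 2) - (∫ x in cube, f x) ^ 2
      - 1/12 * ∑ j ∈ A, β j ^ 2 := by
    rw [hL]
    refine ciInf_ciInf_eq_of_le_of_eq (fun φ₀ φ => ?_)
      (a := (∫ x in cube, f x) - ∑ j ∈ A, β j * (1/2)) (c := β) ?_
    · rw [hloss, add_assoc]
      exact le_add_of_nonneg_right (by positivity)
    · rw [hloss]; simp
  rw [hmin, hmin, Finset.sum_sdiff_sub_sum_sdiff]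
  ring
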